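/- arXiv:2112.12747 — 3 statements merged into one kernel-verified Lean document; each statement's English description precedes it below -/
import Mathlib

section
/- Let μ be a finite complex Borel measure on a measurable space X and let g : X → ℝ be a measurable function. Then lim_{T→∞} (1/T) ∫₀^T ( ∫_X e^{i t g(λ)} dμ(λ) ) dt = μ( { λ ∈ X : g(λ) = 0 } ). -/
open MeasureTheory Filter Topology

/-- The time average of a nontrivial character vanishes in the limit, that of the trivial one
is `1`. -/
theorem tendsto_average_cexp (a : ℝ) :
    Tendsto (fun T : ℝ => (1 / (T : ℂ)) * ∫ t in (0:ℝ)..T, Complex.exp (Complex.I * (t * a)))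
      atTop (𝓝 (if a = 0 then 1 else 0)) := by
  split_ifs with ha
  · refine tendsto_const_nhds.congr' ?_
    filter_upwards [eventually_ne_atTop 0] with T hT
    have hT' : (T : ℂ) ≠ 0 := by exact_mod_cast hT
    simp [ha, hT']
  · have hc : Complex.I * (a : ℂ) ≠ 0 := by simp [ha]
    refine squeeze_zero_norm (a := fun T : ℝ => |T|⁻¹ * (2 / |a|)) ?_ ?_
    · intro T
      have h : ∫ t in (0:ℝ)..T, Complex.exp (Complex.I * (t * a)) =
          (Complex.exp (Complex.I * a * T) - Complex.exp (Complex.I * a * (0 : ℝ))) /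
            (Complex.I * a) := by
        rw [← integral_exp_mul_complex hc]
        congr 1; ext t; ring_nf
      have hexp (s : ℝ) : ‖Complex.exp (Complex.I * a * s)‖ = 1 := by
        rw [mul_assoc, mul_comm, ← Complex.ofReal_mul, Complex.norm_exp_ofReal_mul_I]
      have hsub : ‖Complex.exp (Complex.I * a * T) - Complex.exp (Complex.I * a * (0 : ℝ))‖ ≤ 2 :=
        (norm_sub_le _ _).trans (by rw [hexp, hexp]; norm_num)
      have hden : ‖Complex.I * (a : ℂ)‖ = |a| := by simp
      rw [h, norm_mul, norm_div, norm_div, hden, norm_one, Complex.norm_real, Real.norm_eq_abs,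
        one_div]
      gcongr
    · simpa using (tendsto_inv_atTop_zero.comp tendsto_abs_atTop_atTop).mul_const (2 / |a|)

theorem norm_average_cexp_le (T a : ℝ) :
    ‖(1 / (T : ℂ)) * ∫ t in (0:ℝ)..T, Complex.exp (Complex.I * (t * a))‖ ≤ 1 := by
  have h : ‖∫ t in (0:ℝ)..T, Complex.exp (Complex.I * (t * a))‖ ≤ 1 * |T - 0| := by
    refine intervalIntegral.norm_integral_le_of_norm_le_const fun t _ => ?_
    rw [mul_comm, ← Complex.ofReal_mul, Complex.norm_exp_ofReal_mul_I]
  rw [norm_mul, norm_div, norm_one, Complex.norm_real, Real.norm_eq_abs, one_div]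
  calc |T|⁻¹ * _ ≤ |T|⁻¹ * |T| := by gcongr; simpa using h
    _ ≤ 1 := inv_mul_le_one

theorem continuous_average_cexp (T : ℝ) :
    Continuous fun a : ℝ =>
      (1 / (T : ℂ)) * ∫ t in (0:ℝ)..T, Complex.exp (Complex.I * (t * a)) :=
  continuous_const.mul <|
    intervalIntegral.continuous_parametric_intervalIntegral_of_continuous' (by fun_prop) 0 T

/-- Fubini for the time average of the Fourier transform of `f ρ` along `g`. -/
theorem average_integral_cexp_mul {X : Type*} [MeasurableSpace X] (ρ : Measure X) [SFinite ρ]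
    {f : X → ℂ} (hf : Integrable f ρ) {g : X → ℝ} (hg : Measurable g) (T : ℝ) :
    (1 / (T : ℂ)) * ∫ t in (0:ℝ)..T, ∫ x, Complex.exp (Complex.I * (t * g x)) * f x ∂ρ =
      ∫ x, ((1 / (T : ℂ)) * ∫ t in (0:ℝ)..T, Complex.exp (Complex.I * (t * g x))) * f x ∂ρ := by
  have : IsFiniteMeasure ((volume : Measure ℝ).restrict (Set.uIoc 0 T)) :=
    ⟨by simp [Set.uIoc]⟩
  have hint : Integrable (Function.uncurry fun (t : ℝ) (x : X) =>
      Complex.exp (Complex.I * (t * g x)) * f x)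
      ((volume.restrict (Set.uIoc 0 T)).prod ρ) := by
    refine (hf.comp_snd (volume.restrict (Set.uIoc 0 T))).bdd_mul (c := 1) ?_ ?_
    · exact Measurable.aestronglyMeasurable (by fun_prop)
    · refine Eventually.of_forall fun p => ?_
      rw [mul_comm, ← Complex.ofReal_mul, Complex.norm_exp_ofReal_mul_I]
  rw [intervalIntegral_integral_swap hint, ← integral_const_mul]
  simp_rw [intervalIntegral.integral_mul_const, mul_assoc]

/-- Wiener-type averaging lemma. A finite complex Borel measure on a
measurable space `X` is encoded, via its Radon–Nikodym representation with respect to its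
(finite, positive) total variation measure `ρ`, as the measure `E ↦ ∫ x in E, f x ∂ρ` with
`f : X → ℂ` integrable; this representation is fully general. The inner integral
`∫ e^{i t g(λ)} dμ(λ)` is then `∫ x, e^{i t g x} * f x ∂ρ` and the mass of the zero set
`{g = 0}` is `∫ x in {g = 0}, f x ∂ρ`. -/
theorem stmt_5 {X : Type*} [MeasurableSpace X] (ρ : Measure X) [IsFiniteMeasure ρ]
    (f : X → ℂ) (hf : Integrable f ρ) (g : X → ℝ) (hg : Measurable g) :
    Tendsto (fun T : ℝ => (1 / (T : ℂ)) *
        ∫ t in (0:ℝ)..T, ∫ x, Complex.exp (Complex.I * (t * g x)) * f x ∂ρ)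
      atTop (𝓝 (∫ x in {x | g x = 0}, f x ∂ρ)) := by
  have hlim : ∫ x in {x | g x = 0}, f x ∂ρ = ∫ x, (if g x = 0 then 1 else 0) * f x ∂ρ := by
    rw [← integral_indicator (measurableSet_eq_fun hg measurable_const)]
    congr 1; ext x
    by_cases hx : g x = 0 <;> simp [hx]
  simp_rw [hlim, average_integral_cexp_mul ρ hf hg]
  refine tendsto_integral_filter_of_dominated_convergence (fun x => ‖f x‖) ?_ ?_ hf.norm ?_
  · exact Eventually.of_forall fun T =>
      ((continuous_average_cexp T).measurable.comp hg).aestronglyMeasurable.mul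
        hf.aestronglyMeasurable
  · refine Eventually.of_forall fun T => Eventually.of_forall fun x => ?_
    rw [norm_mul]
    exact mul_le_of_le_one_left (norm_nonneg _) (norm_average_cexp_le T (g x))
  · exact Eventually.of_forall fun x => (tendsto_average_cexp (g x)).mul_const (f x)
end

section
/- Let v ∈ ℝ \ {0} and θ, ω ∈ ℝ be such that ω + v(θ + 2πm) ≠ 0 for every integer m. Then lim_{T→∞} (1/T) ∫₀^T e^{i(ω t + θ ⌊v t⌋)} dt = 0, where ⌊·⌋ denotes the integer part (floor). -/
open MeasureTheory Filter Topology Real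

/-- A primitive of a function that is quasi-periodic with a unimodular multiplier different
from `1` is bounded. -/
lemma exists_norm_integral_le_of_quasiperiodic {f : ℝ → ℂ} {p : ℝ} {z : ℂ}
    (hf : ∀ a b : ℝ, IntervalIntegrable f volume a b) (hp : p ≠ 0)
    (hz : ‖z‖ = 1) (hz1 : z ≠ 1) (hper : ∀ t, f (t + p) = z * f t) :
    ∃ C : ℝ, ∀ T : ℝ, ‖∫ t in (0:ℝ)..T, f t‖ ≤ C := by
  have hz1' : 1 - z ≠ 0 := sub_ne_zero.2 hz1.symm
  set c : ℂ := (∫ t in (0:ℝ)..p, f t) / (1 - z) with hc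
  have hshift (T : ℝ) : (∫ t in (0:ℝ)..(T + p), f t) - c
      = z * ((∫ t in (0:ℝ)..T, f t) - c) := by
    have h : ∫ t in p..(T + p), f t = z * ∫ t in (0:ℝ)..T, f t := by
      rw [← intervalIntegral.integral_const_mul]
      simp_rw [← hper]
      rw [intervalIntegral.integral_comp_add_right, zero_add]
    rw [← intervalIntegral.integral_add_adjacent_intervals (hf 0 p) (hf p (T + p)), h, hc]
    field_simp
    ring
  have hperiodic : Function.Periodic (fun T : ℝ => ‖(∫ t in (0:ℝ)..T, f t) - c‖) p := by
    intro T
    simp only [hshift, norm_mul, hz, one_mul]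
  have hcont : Continuous (fun T : ℝ => ‖(∫ t in (0:ℝ)..T, f t) - c‖) :=
    ((intervalIntegral.continuous_primitive hf 0).sub continuous_const).norm
  obtain ⟨C, hC⟩ := (hperiodic.isBounded_of_continuous hp hcont).bddAbove
  refine ⟨C + ‖c‖, fun T => ?_⟩
  have h1 : ‖(∫ t in (0:ℝ)..T, f t) - c‖ ≤ C := hC ⟨T, rfl⟩
  have h2 := norm_add_le ((∫ t in (0:ℝ)..T, f t) - c) c
  rw [sub_add_cancel] at h2
  linarith

/-- away from all resonances `ω + v(θ + 2πm) = 0` (m ∈ ℤ), the lattice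
ray-average of the phase `e^{i(ω t + θ ⌊v t⌋)}` tends to zero. -/
theorem stmt_6 (v θ ω : ℝ) (hv : v ≠ 0)
    (hres : ∀ m : ℤ, ω + v * (θ + 2 * π * m) ≠ 0) :
    Tendsto (fun T : ℝ => (1 / (T : ℂ)) *
        ∫ t in (0:ℝ)..T, Complex.exp (Complex.I * ((ω * t : ℝ) + θ * (⌊v * t⌋ : ℝ))))
      atTop (𝓝 0) := by
  have hint (a b : ℝ) : IntervalIntegrable (fun t : ℝ =>
      Complex.exp (Complex.I * ((ω * t : ℝ) + θ * (⌊v * t⌋ : ℝ)))) volume a b := by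
    refine (intervalIntegrable_const (c := (1 : ℝ))).mono_fun
      (Measurable.aestronglyMeasurable ?_) (Eventually.of_forall fun t => ?_)
    · have h : Measurable fun t : ℝ => ((⌊v * t⌋ : ℤ) : ℝ) :=
        measurable_from_top.comp (Int.measurable_floor.comp (measurable_const_mul v))
      fun_prop
    · beta_reduce
      rw [← Complex.ofReal_mul, ← Complex.ofReal_add, Complex.norm_exp_I_mul_ofReal, norm_one]
  have hmul : Complex.exp (Complex.I * ((ω / v + θ : ℝ) : ℂ)) ≠ 1 := by
    intro h
    obtain ⟨n, hn⟩ := Complex.exp_eq_one_iff.1 h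
    have h1 : ((ω / v + θ : ℝ) : ℂ) = ((n * (2 * π) : ℝ) : ℂ) := by
      apply mul_left_cancel₀ Complex.I_ne_zero
      rw [hn]
      push_cast
      ring
    have h2 : ω / v + θ = n * (2 * π) := Complex.ofReal_injective h1
    apply hres (-n)
    field_simp at h2
    push_cast
    linarith
  obtain ⟨C, hC⟩ := exists_norm_integral_le_of_quasiperiodic hint (inv_ne_zero hv)
    (Complex.norm_exp_I_mul_ofReal _) hmul (fun t => by
      have h : v * (t + v⁻¹) = v * t + 1 := by field_simp
      rw [h, Int.floor_add_one, ← Complex.exp_add]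
      congr 1
      push_cast
      ring)
  have hlim : Tendsto (fun T : ℝ => |T|⁻¹ * C) atTop (𝓝 0) := by
    simpa using (tendsto_inv_atTop_zero.comp tendsto_abs_atTop_atTop).mul_const C
  refine squeeze_zero_norm (fun T => ?_) hlim
  rw [norm_mul, one_div, norm_inv, Complex.norm_real, Real.norm_eq_abs]
  exact mul_le_mul_of_nonneg_left (hC T) (by positivity)
end

section
/- Let g : ℝ → ℂ be a bounded measurable function satisfying g(−t) = conj(g(t)) for all t ∈ ℝ. If lim_{T→∞} (1/T) ∫₀^T g(t) dt = 0, then lim_{T→∞} (1/T²) ∫₀^T ∫₀^T g(t − s) dt ds = 0. -/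
open MeasureTheory Filter Topology

/-- The primitive of a Hermitian-symmetric function has an even norm. -/
lemma norm_integral_zero_neg_of_hermitian {g : ℝ → ℂ}
    (hherm : ∀ t : ℝ, g (-t) = (starRingEnd ℂ) (g t)) (u : ℝ) :
    ‖∫ t in (0:ℝ)..(-u), g t‖ = ‖∫ t in (0:ℝ)..u, g t‖ := by
  have h : ∫ t in (0:ℝ)..u, g (-t) = (starRingEnd ℂ) (∫ t in (0:ℝ)..u, g t) := by
    simp only [hherm, intervalIntegral, map_sub, integral_conj]
  rw [intervalIntegral.integral_comp_neg, neg_zero] at h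
  rw [intervalIntegral.integral_symm, h, norm_neg, RCLike.norm_conj]

/-- If the averages of a bounded function tend to zero, its primitive is eventually at most `ε * T`
uniformly on `[0, T]`. -/
lemma eventually_norm_integral_le_of_average_tendsto_zero {g : ℝ → ℂ} {C : ℝ}
    (hC : ∀ t : ℝ, ‖g t‖ ≤ C)
    (havg : Tendsto (fun T : ℝ => (1 / (T : ℂ)) * ∫ t in (0:ℝ)..T, g t) atTop (𝓝 0))
    {ε : ℝ} (hε : 0 < ε) :
    ∀ᶠ T : ℝ in atTop, ∀ t ∈ Set.Icc 0 T, ‖∫ s in (0:ℝ)..t, g s‖ ≤ ε * T := by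
  have hC0 : 0 ≤ C := (norm_nonneg _).trans (hC 0)
  obtain ⟨M, hM⟩ := eventually_atTop.1
    ((Metric.tendsto_nhds.1 havg ε hε).and (eventually_gt_atTop 0))
  have hM0 : 0 < M := (hM M le_rfl).2
  filter_upwards [eventually_ge_atTop (C * M / ε)] with T hT t ht
  rcases le_total M t with h | h
  · obtain ⟨h1, h2⟩ := hM t h
    rw [dist_zero_right, norm_mul, norm_div, norm_one, Complex.norm_real, Real.norm_of_nonneg h2.le,
      one_div_mul_eq_div, div_lt_iff₀ h2] at h1
    exact h1.le.trans (by gcongr; exact ht.2)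
  · calc ‖∫ s in (0:ℝ)..t, g s‖ ≤ C * |t - 0| :=
          intervalIntegral.norm_integral_le_of_norm_le_const fun s _ => hC s
      _ ≤ C * M := by rw [sub_zero, abs_of_nonneg ht.1]; gcongr
      _ ≤ ε * T := by rw [div_le_iff₀ hε] at hT; linarith

/-- ergodicity implies mean-square ergodicity, scalar form. If the
time average of a bounded measurable Hermitian-symmetric `g : ℝ → ℂ` vanishes, then so
does the double time average of `g(t - s)` over the square `[0,T]²`. -/
theorem stmt_11 (g : ℝ → ℂ) (hmeas : Measurable g) (hbd : ∃ C : ℝ, ∀ t : ℝ, ‖g t‖ ≤ C)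
    (hherm : ∀ t : ℝ, g (-t) = (starRingEnd ℂ) (g t))
    (havg : Tendsto (fun T : ℝ => (1 / (T : ℂ)) * ∫ t in (0:ℝ)..T, g t) atTop (𝓝 0)) :
    Tendsto (fun T : ℝ => (1 / (T : ℂ) ^ 2) * ∫ t in (0:ℝ)..T, ∫ s in (0:ℝ)..T, g (t - s))
      atTop (𝓝 0) := by
  obtain ⟨C, hC⟩ := hbd
  have hint (a b : ℝ) : IntervalIntegrable g volume a b :=
    (intervalIntegrable_const (c := C)).mono_fun hmeas.aestronglyMeasurable
      (ae_of_all _ fun t => (hC t).trans (le_abs_self C))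
  rw [Metric.tendsto_nhds]
  intro ε hε
  filter_upwards [eventually_norm_integral_le_of_average_tendsto_zero hC havg
    (show 0 < ε / 4 by positivity), eventually_gt_atTop 0] with T hG hT
  have hinner : ∀ t ∈ Set.uIoc 0 T, ‖∫ s in (0:ℝ)..T, g (t - s)‖ ≤ ε / 2 * T := by
    intro t ht
    rw [Set.uIoc_of_le hT.le] at ht
    have hneg := norm_integral_zero_neg_of_hermitian hherm (T - t)
    rw [neg_sub] at hneg
    have h1 := hG t ⟨ht.1.le, ht.2⟩
    have h2 := hG (T - t) ⟨by linarith [ht.2], by linarith [ht.1]⟩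
    rw [intervalIntegral.integral_comp_sub_left, sub_zero,
      ← intervalIntegral.integral_interval_sub_left (hint 0 t) (hint 0 (t - T))]
    linarith [norm_sub_le (∫ s in (0:ℝ)..t, g s) (∫ s in (0:ℝ)..(t - T), g s)]
  have houter := intervalIntegral.norm_integral_le_of_norm_le_const hinner
  rw [sub_zero, abs_of_pos hT] at houter
  rw [dist_zero_right, norm_mul, norm_div, norm_one, norm_pow, Complex.norm_real,
    Real.norm_of_nonneg hT.le, one_div_mul_eq_div, div_lt_iff₀ (by positivity)]
  nlinarith [mul_pos hε (pow_pos hT 2)]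
end
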